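/- Let H be a real Hilbert space, let F, G : H → [0,∞] be proper, lower semicontinuous, convex functionals, and let δ ≥ 0 be such that F(u) − δ ≤ G(u) ≤ F(u) + δ for all u ∈ H. Let τ > 0 and u₀, v₀ ∈ H. Then for every n ∈ ℕ, the n-fold proximal iterates satisfy ‖(J_τ^F)ⁿ[u₀] − (J_τ^G)ⁿ[v₀]‖ ≤ ‖u₀ − v₀‖ + 2 n √(δτ). -/

import Mathlib

open scoped ENNReal

/-- Convexity of a `[0,∞]`-valued functional, with the conventions of
extended arithmetic (in particular `0 * ∞ = 0`). -/
def EConvexOn {H : Type*} [AddCommGroup H] [Module ℝ H] (F : H → ℝ≥0∞) : Prop :=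
  ∀ u v : H, ∀ a b : ℝ, 0 ≤ a → 0 ≤ b → a + b = 1 →
    F (a • u + b • v) ≤ ENNReal.ofReal a * F u + ENNReal.ofReal b * F v

/-- `m` is the proximal point `J_τ^F[u₀]`, i.e. a minimizer of
`u ↦ (1/(2τ))‖u − u₀‖² + F(u)`. -/
def IsProx {H : Type*} [NormedAddCommGroup H] (F : H → ℝ≥0∞) (τ : ℝ) (u₀ m : H) : Prop :=
  ∀ u : H,
    ENNReal.ofReal ((1 / (2 * τ)) * ‖m - u₀‖ ^ 2) + F m ≤
      ENNReal.ofReal ((1 / (2 * τ)) * ‖u - u₀‖ ^ 2) + F u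

theorem IsProx.ne_top {H : Type*} [NormedAddCommGroup H] {F : H → ℝ≥0∞} {τ : ℝ} {w m : H}
    (hm : IsProx F τ w m) (hF : ∃ u, F u ≠ ∞) : F m ≠ ∞ := by
  obtain ⟨u, hu⟩ := hF
  exact ne_top_of_le_ne_top (ENNReal.add_ne_top.2 ⟨ENNReal.ofReal_ne_top, hu⟩)
    (le_add_self.trans (hm u))

/-- The variational inequality characterizing a proximal point. -/
theorem IsProx.inner_le {H : Type*} [NormedAddCommGroup H] [InnerProductSpace ℝ H]
    {F : H → ℝ≥0∞} {τ : ℝ} {w m u : H} (hm : IsProx F τ w m) (hF : EConvexOn F) (hτ : 0 < τ)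
    (hmtop : F m ≠ ∞) (hutop : F u ≠ ∞) :
    inner ℝ (w - m) (u - m) ≤ τ * ((F u).toReal - (F m).toReal) := by
  have key : ∀ t : ℝ, 0 < t → t ≤ 1 →
      inner ℝ (w - m) (u - m) - τ * ((F u).toReal - (F m).toReal) ≤ t * (‖u - m‖ ^ 2 / 2) := by
    intro t ht ht1
    have h := (hm ((1 - t) • m + t • u)).trans
      (add_le_add_right (hF m u (1 - t) t (by linarith) ht.le (by ring)) _)
    rw [← ENNReal.ofReal_toReal hmtop, ← ENNReal.ofReal_toReal hutop,
      ← ENNReal.ofReal_mul (by linarith), ← ENNReal.ofReal_mul ht.le,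
      ← ENNReal.ofReal_add (by positivity) (by positivity),
      ← ENNReal.ofReal_add (mul_nonneg (by linarith) ENNReal.toReal_nonneg) (by positivity),
      ← ENNReal.ofReal_add (by positivity)
        (add_nonneg (mul_nonneg (by linarith) ENNReal.toReal_nonneg) (by positivity)),
      ENNReal.ofReal_le_ofReal_iff (add_nonneg (by positivity)
        (add_nonneg (mul_nonneg (by linarith) ENNReal.toReal_nonneg) (by positivity)))] at h
    have hsq : ‖(1 - t) • m + t • u - w‖ ^ 2 =
        ‖m - w‖ ^ 2 - 2 * t * inner ℝ (w - m) (u - m) + t ^ 2 * ‖u - m‖ ^ 2 := by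
      rw [show (1 - t) • m + t • u - w = t • (u - m) - (w - m) by module, norm_sub_sq_real,
        norm_smul, inner_smul_left, real_inner_comm, norm_sub_rev w m, mul_pow, Real.norm_eq_abs,
        sq_abs, conj_trivial]
      ring
    rw [hsq] at h
    have h2 := mul_le_mul_of_nonneg_left h hτ.le
    field_simp at h2
    refine le_of_mul_le_mul_left ?_ ht
    linarith
  have hlim : Filter.Tendsto (fun t : ℝ => t * (‖u - m‖ ^ 2 / 2)) (nhdsWithin 0 (Set.Ioi 0))
      (nhds 0) :=
    ((by fun_prop : Continuous fun t : ℝ => t * (‖u - m‖ ^ 2 / 2)).tendsto' 0 0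
      (by simp)).mono_left nhdsWithin_le_nhds
  refine sub_nonpos.1 (ge_of_tendsto hlim ?_)
  filter_upwards [Ioc_mem_nhdsGT (zero_lt_one' ℝ)] with t ht using key t ht.1 ht.2

/-- One proximal step for two functionals at uniform distance at most `δ`. -/
theorem IsProx.norm_sub_le {H : Type*} [NormedAddCommGroup H] [InnerProductSpace ℝ H]
    {F G : H → ℝ≥0∞} {δ τ : ℝ} {x y p q : H} (hp : IsProx F τ x p) (hq : IsProx G τ y q)
    (hF : ∃ u, F u ≠ ∞) (hG : ∃ u, G u ≠ ∞) (hFconv : EConvexOn F) (hGconv : EConvexOn G)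
    (hδ : 0 ≤ δ) (hFG : ∀ u, F u ≤ G u + ENNReal.ofReal δ ∧ G u ≤ F u + ENNReal.ofReal δ)
    (hτ : 0 < τ) : ‖p - q‖ ≤ ‖x - y‖ + 2 * Real.sqrt (δ * τ) := by
  have hFp := hp.ne_top hF
  have hGq := hq.ne_top hG
  have hFq : F q ≠ ∞ :=
    ne_top_of_le_ne_top (ENNReal.add_ne_top.2 ⟨hGq, ENNReal.ofReal_ne_top⟩) (hFG q).1
  have hGp : G p ≠ ∞ :=
    ne_top_of_le_ne_top (ENNReal.add_ne_top.2 ⟨hFp, ENNReal.ofReal_ne_top⟩) (hFG p).2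
  have h1 := hp.inner_le hFconv hτ hFp hFq
  have h2 := hq.inner_le hGconv hτ hGq hGp
  have h3 : (F q).toReal ≤ (G q).toReal + δ := by
    have := ENNReal.toReal_mono (ENNReal.add_ne_top.2 ⟨hGq, ENNReal.ofReal_ne_top⟩) (hFG q).1
    rwa [ENNReal.toReal_add hGq ENNReal.ofReal_ne_top, ENNReal.toReal_ofReal hδ] at this
  have h4 : (G p).toReal ≤ (F p).toReal + δ := by
    have := ENNReal.toReal_mono (ENNReal.add_ne_top.2 ⟨hFp, ENNReal.ofReal_ne_top⟩) (hFG p).2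
    rwa [ENNReal.toReal_add hFp ENNReal.ofReal_ne_top, ENNReal.toReal_ofReal hδ] at this
  have hsum : inner ℝ (x - p) (q - p) + inner ℝ (y - q) (p - q) =
      ‖p - q‖ ^ 2 - inner ℝ (x - y) (p - q) := by
    rw [← neg_sub p q, inner_neg_right, neg_add_eq_sub, ← inner_sub_left,
      show y - q - (x - p) = (p - q) - (x - y) by abel, inner_sub_left, real_inner_self_eq_norm_sq]
  have hcs := real_inner_le_norm (x - y) (p - q)
  have hbd : τ * ((F q).toReal - (F p).toReal) + τ * ((G p).toReal - (G q).toReal) ≤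
      2 * (δ * τ) := by
    nlinarith
  have hs := Real.sq_sqrt (mul_nonneg hδ hτ.le)
  have hs0 := Real.sqrt_nonneg (δ * τ)
  by_contra! hlt
  nlinarith [norm_nonneg (x - y), norm_nonneg (p - q),
    mul_nonneg hs0 (norm_nonneg (x - y)),
    mul_pos (sub_pos.2 hlt) (by nlinarith [norm_nonneg (x - y)] : 0 < ‖p - q‖),
    mul_nonneg hs0 (sub_pos.2 hlt).le]

/-- If `F(u) − δ ≤ G(u) ≤ F(u) + δ` for all `u` (in the extended reals), then the `n`-fold
proximal iterates satisfy `‖(J_τ^F)ⁿ[u₀] − (J_τ^G)ⁿ[v₀]‖ ≤ ‖u₀ − v₀‖ + 2n√(δτ)`. -/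
theorem prox_iterates_comparison {H : Type*} [NormedAddCommGroup H] [InnerProductSpace ℝ H]
    [CompleteSpace H]
    (F G : H → ℝ≥0∞) (hFproper : ∃ u, F u ≠ ∞) (hGproper : ∃ u, G u ≠ ∞)
    (hFlsc : LowerSemicontinuous F) (hGlsc : LowerSemicontinuous G)
    (hFconv : EConvexOn F) (hGconv : EConvexOn G)
    (δ : ℝ) (hδ : 0 ≤ δ)
    (hFG : ∀ u : H, F u ≤ G u + ENNReal.ofReal δ ∧ G u ≤ F u + ENNReal.ofReal δ)
    (τ : ℝ) (hτ : 0 < τ) (JF JG : H → H)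
    (hJF : ∀ w : H, IsProx F τ w (JF w)) (hJG : ∀ w : H, IsProx G τ w (JG w))
    (u₀ v₀ : H) :
    ∀ n : ℕ, ‖JF^[n] u₀ - JG^[n] v₀‖ ≤ ‖u₀ - v₀‖ + 2 * n * Real.sqrt (δ * τ) := by
  intro n
  induction n with
  | zero => simp
  | succ k ih =>
    rw [Function.iterate_succ_apply', Function.iterate_succ_apply']
    have := (hJF (JF^[k] u₀)).norm_sub_le (hJG (JG^[k] v₀)) hFproper hGproper hFconv hGconv hδ
      hFG hτ
    push_cast
    linarith
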